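/- arXiv:math/0212318 — 3 statements merged into one kernel-verified Lean document; each statement's English description precedes it below -/
import Mathlib

section
/- Let m = (m₁,…,m_k) be positive integers summing to n, let r, s be nonnegative integers with r + s = n, and set ε_i = 1 for 1 ≤ i ≤ r and ε_i = −1 for r < i ≤ n. Let μ ∈ ℂ[t]^k and suppose there is a permutation τ of {1,…,k} with m_{τ(i)} = m_i and c(μ_i) = μ_{τ(i)} for all i. Then there exists a *-structure (relative to c) on the ℂ[t]-algebra A_{m,μ,t} such that ([E^i_j])* = ε_i·ε_j·[E^j_i] for all 1 ≤ i,j ≤ n, where [E^i_j] denotes the class of E^i_j in A_{m,μ,t}. -/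
noncomputable section

open Polynomial MulOpposite

abbrev Ct : Type := Polynomial ℂ

abbrev FA (n : ℕ) : Type := FreeAlgebra Ct (Fin n × Fin n)

/-- The defining relations of `U(g_t)`. -/
inductive glRel (n : ℕ) : FA n → FA n → Prop
  | comm (i j l m : Fin n) :
      glRel n
        (FreeAlgebra.ι Ct ((i, j) : Fin n × Fin n) * FreeAlgebra.ι Ct ((m, l) : Fin n × Fin n)
          - FreeAlgebra.ι Ct ((m, l) : Fin n × Fin n) * FreeAlgebra.ι Ct ((i, j) : Fin n × Fin n))
        ((X : Ct) • ((if j = m then (1 : Ct) else 0) • FreeAlgebra.ι Ct ((i, l) : Fin n × Fin n)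
          - (if i = l then (1 : Ct) else 0) • FreeAlgebra.ι Ct ((m, j) : Fin n × Fin n)))

/-- `U(g_t)`. -/
abbrev Ugt (n : ℕ) : Type := RingQuot (glRel n)

/-- The generator `E^i_j`. -/
def Egen (n : ℕ) (i j : Fin n) : Ugt n :=
  RingQuot.mkAlgHom Ct (glRel n) (FreeAlgebra.ι Ct (i, j))

/-- The matrix `E` with entries in the opposite algebra (used for the "paper" product
convention). -/
def EmatOp (n : ℕ) : Matrix (Fin n) (Fin n) (Ugt n)ᵐᵒᵖ :=
  Matrix.of fun i j => op (Egen n i j)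

/-- The matrix `E`. -/
def Emat (n : ℕ) : Matrix (Fin n) (Fin n) (Ugt n) :=
  Matrix.of fun i j => Egen n i j

/-- Entries of `(E-μ₁)⋯(E-μ_k)` in the paper's convention
`(E^ℓ)^i_j = Σ E^{α₁}_j E^{α₂}_{α₁} ⋯ E^i_{α_{ℓ-1}}`. -/
def prodE (n k : ℕ) (μ : Fin k → Ct) : Matrix (Fin n) (Fin n) (Ugt n) :=
  Matrix.of fun i j =>
    unop (((List.ofFn fun s : Fin k =>
      EmatOp n - algebraMap Ct (Matrix (Fin n) (Fin n) (Ugt n)ᵐᵒᵖ) (μ s)).prod) i j)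

/-- `Tr E^ℓ` in the paper's convention. -/
def trE (n ℓ : ℕ) : Ugt n := unop (Matrix.trace (EmatOp n ^ ℓ))

/-- Entries of `(E-ν₁)∘⋯∘(E-ν_k)` in the opposite convention
`(E^{∘ℓ})^i_j = Σ E^i_{α₁} E^{α₁}_{α₂} ⋯ E^{α_{ℓ-1}}_j`. -/
def prodEop (n k : ℕ) (ν : Fin k → Ct) : Matrix (Fin n) (Fin n) (Ugt n) :=
  (List.ofFn fun s : Fin k =>
    Emat n - algebraMap Ct (Matrix (Fin n) (Fin n) (Ugt n)) (ν s)).prod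

/-- `Tr E^{∘ℓ}`. -/
def trEop (n ℓ : ℕ) : Ugt n := Matrix.trace (Emat n ^ ℓ)

/-- `θ_ℓ(m, μ, τ)`. -/
def theta {R : Type*} [CommRing R] {k : ℕ} (m : Fin k → ℕ) (μ : Fin k → R) (τ : R)
    (ℓ : ℕ) : R :=
  ∑ s ∈ Finset.Icc 1 k,
    if s ≤ ℓ + 1 then
      τ ^ (s - 1) *
        ∑ J ∈ Finset.powersetCard s (Finset.univ : Finset (Fin k)),
          (∏ j ∈ J, (m j : R)) *
            ∑ d ∈ J.finsuppAntidiag (ℓ + 1 - s), ∏ j ∈ J, μ j ^ d j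
    else 0

/-- Generators of the two-sided ideal `I_{m,μ,t}`. -/
def genSetA (n k : ℕ) (m : Fin k → ℕ) (μ : Fin k → Ct) : Set (Ugt n) :=
  {u | ∃ i j : Fin n, u = prodE n k μ i j} ∪
  {u | ∃ ℓ ∈ Finset.Icc 1 (k - 1), u = trE n ℓ - algebraMap Ct (Ugt n) (theta m μ X ℓ)}

/-- The two-sided ideal `I_{m,μ,t}`. -/
def IdealA (n k : ℕ) (m : Fin k → ℕ) (μ : Fin k → Ct) : TwoSidedIdeal (Ugt n) :=
  TwoSidedIdeal.span (genSetA n k m μ)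

/-- The algebra `A_{m,μ,t}`, the quotient of `U(g_t)` by the two-sided ideal generated by
`genSetA`. -/
abbrev AlgA (n k : ℕ) (m : Fin k → ℕ) (μ : Fin k → Ct) : Type :=
  RingQuot (fun a b : Ugt n => a - b ∈ genSetA n k m μ)

noncomputable instance instRingRingQuotUgt (n : ℕ) (r : Ugt n → Ugt n → Prop) :
    Ring (RingQuot r) :=
  RingQuot.instRing r

/-- The class of `u ∈ U(g_t)` in `A_{m,μ,t}`. -/
def clsA (n k : ℕ) (m : Fin k → ℕ) (μ : Fin k → Ct) (u : Ugt n) : AlgA n k m μ :=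
  RingQuot.mkAlgHom Ct _ u

/-- Generators of the two-sided ideal `I°_{m,ν,t}`. -/
def genSetAop (n k : ℕ) (m : Fin k → ℕ) (ν : Fin k → Ct) : Set (Ugt n) :=
  {u | ∃ i j : Fin n, u = prodEop n k ν i j} ∪
  {u | ∃ ℓ ∈ Finset.Icc 1 (k - 1), u = trEop n ℓ - algebraMap Ct (Ugt n) (theta m ν (-X) ℓ)}

/-- The two-sided ideal `I°_{m,ν,t}`. -/
def IdealAop (n k : ℕ) (m : Fin k → ℕ) (ν : Fin k → Ct) : TwoSidedIdeal (Ugt n) :=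
  TwoSidedIdeal.span (genSetAop n k m ν)

/-- The algebra `A°_{m,ν,t}`. -/
abbrev AlgAop (n k : ℕ) (m : Fin k → ℕ) (ν : Fin k → Ct) : Type :=
  RingQuot (fun a b : Ugt n => a - b ∈ genSetAop n k m ν)

/-- The block index (as a natural number) of `a : Fin n` for block sizes `m`. -/
def blk (k : ℕ) (m : Fin k → ℕ) (a : ℕ) : ℕ :=
  (Finset.univ.filter fun i : Fin k => ∑ j ∈ Finset.Iic i, m j ≤ a).card

/-- The parabolic subalgebra `p_t`: block upper-triangular matrices. -/
def pSet (n k : ℕ) (m : Fin k → ℕ) : Set (Matrix (Fin n) (Fin n) Ct) :=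
  {x | ∀ a b : Fin n, blk k m b < blk k m a → x a b = 0}

/-- Extension of `lam : Fin k → ℂ` to `ℕ`. -/
def lamExt (k : ℕ) (lam : Fin k → ℂ) (i : ℕ) : ℂ :=
  if h : i < k then lam ⟨i, h⟩ else 0

/-- The character `λ` of `p_t`, `x ↦ Σ_i λ_i tr(x_ii)`. -/
def pChar (n k : ℕ) (m : Fin k → ℕ) (lam : Fin k → ℂ) (x : Matrix (Fin n) (Fin n) Ct) : Ct :=
  ∑ a : Fin n, C (lamExt k lam (blk k m a)) * x a a

/-- The canonical linear map `g_t → U(g_t)`. -/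
def iotaU (n : ℕ) (x : Matrix (Fin n) (Fin n) Ct) : Ugt n :=
  ∑ i : Fin n, ∑ j : Fin n, x i j • Egen n i j

/-- The left ideal `L_λ` defining the generalized Verma module. -/
def VermaIdeal (n k : ℕ) (m : Fin k → ℕ) (lam : Fin k → ℂ) : Submodule (Ugt n) (Ugt n) :=
  Submodule.span (Ugt n)
    {u | ∃ x ∈ pSet n k m, u = iotaU n x - algebraMap Ct (Ugt n) (pChar n k m lam x)}

noncomputable instance instHasQuotientUgt (n : ℕ) :
    HasQuotient (Ugt n) (Submodule (Ugt n) (Ugt n)) := by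
  with_unfolding_all exact @Submodule.hasQuotient (Ugt n) (Ugt n) _ _ Semiring.toModule

noncomputable instance instAddCommGroupQuotUgt (n : ℕ) (p : Submodule (Ugt n) (Ugt n)) :
    AddCommGroup (Ugt n ⧸ p) := by
  with_unfolding_all exact @Submodule.Quotient.addCommGroup (Ugt n) (Ugt n) _ _ Semiring.toModule p

noncomputable instance instModuleQuotUgt (n : ℕ) (p : Submodule (Ugt n) (Ugt n)) :
    Module (Ugt n) (Ugt n ⧸ p) := by
  with_unfolding_all exact @Submodule.Quotient.module (Ugt n) (Ugt n) _ _ Semiring.toModule p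

/-- The generalized Verma module `V_{p_t,λ} = U(g_t)/L_λ`. -/
abbrev Verma (n k : ℕ) (m : Fin k → ℕ) (lam : Fin k → ℂ) : Type :=
  Ugt n ⧸ VermaIdeal n k m lam

/-- The annihilator `J_{p_t,λ}` of the generalized Verma module, as a set. -/
def annSet (n k : ℕ) (m : Fin k → ℕ) (lam : Fin k → ℂ) : Set (Ugt n) :=
  {u | ∀ v : Verma n k m lam, u • v = 0}

/-- The ring involution of `ℂ[t]` conjugating the coefficients and fixing `t`. -/
def cconj : Ct → Ct := fun f => f.map (starRingEnd ℂ)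

/-- A `*`-structure on a `ℂ[t]`-algebra `B` relative to `cconj`: an additive,
`cconj`-semilinear, unital, involutive anti-automorphism. -/
def IsStarStructure {B : Type*} [Ring B] [Algebra Ct B] (s : B → B) : Prop :=
  (∀ u v : B, s (u + v) = s u + s v) ∧
  (∀ (f : Ct) (u : B), s (f • u) = cconj f • s u) ∧
  (∀ u v : B, s (u * v) = s v * s u) ∧
  s 1 = 1 ∧
  ∀ u : B, s (s u) = u

/-- Coefficientwise complex conjugation on `ℂ[t]`, as a ring homomorphism. -/
def cconjHom : Ct →+* Ct := Polynomial.mapRingHom (starRingEnd ℂ)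

lemma cconjHom_apply (f : Ct) : cconjHom f = cconj f := rfl

lemma cconjHom_X : cconjHom X = X := by simp [cconjHom]

lemma cconjHom_cconjHom (f : Ct) : cconjHom (cconjHom f) = f := by
  ext i
  simp [cconjHom]

lemma map_theta {R S : Type*} [CommRing R] [CommRing S] {k : ℕ} (f : R →+* S)
    (m : Fin k → ℕ) (μ : Fin k → R) (t : R) (ℓ : ℕ) :
    f (theta m μ t ℓ) = theta m (fun i => f (μ i)) (f t) ℓ := by
  simp only [theta, map_sum, apply_ite f, map_mul, map_pow, map_prod, map_natCast, map_zero]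

lemma theta_comp_perm {R : Type*} [CommRing R] {k : ℕ} (τ : Equiv.Perm (Fin k))
    (m : Fin k → ℕ) (μ : Fin k → R) (t : R) (ℓ : ℕ) :
    theta (fun i => m (τ i)) (fun i => μ (τ i)) t ℓ = theta m μ t ℓ := by
  unfold theta
  refine Finset.sum_congr rfl fun s _ => ?_
  split_ifs with h
  swap
  · rfl
  congr 1
  refine Finset.sum_nbij' (fun J => J.map τ.toEmbedding) (fun J => J.map τ.symm.toEmbedding)
    ?_ ?_ ?_ ?_ ?_
  · intro J hJ
    simpa [Finset.mem_powersetCard] using hJ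
  · intro J hJ
    simpa [Finset.mem_powersetCard] using hJ
  · intro J _
    ext x
    simp
  · intro J _
    ext x
    simp
  · intro J _
    congr 1
    · simp
    · refine Finset.sum_nbij' (fun d => d.equivMapDomain τ) (fun d => d.equivMapDomain τ.symm)
        ?_ ?_ ?_ ?_ ?_
      · intro d hd
        simp only [Finset.mem_finsuppAntidiag] at hd ⊢
        refine ⟨by simpa using hd.1, fun x hx => ?_⟩
        have := @hd.2 (τ.symm x) (by simpa using hx)
        simpa [Finset.mem_map_equiv] using this
      · intro d hd
        simp only [Finset.mem_finsuppAntidiag] at hd ⊢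
        have hs : ∑ x ∈ J, d (τ x) = ℓ + 1 - s := by simpa using hd.1
        refine ⟨hs ▸ Finset.sum_congr rfl fun x _ => by simp, fun x hx => ?_⟩
        have := @hd.2 (τ x) (by simpa using hx)
        simpa [Finset.mem_map_equiv] using this
      · intro d _
        ext x
        simp
      · intro d _
        ext x
        simp
      · intro d _
        simp

lemma cconjHom_theta {k : ℕ} (m : Fin k → ℕ) (μ : Fin k → Ct) (τ : Equiv.Perm (Fin k))
    (hτm : ∀ i, m (τ i) = m i) (hτμ : ∀ i, cconj (μ i) = μ (τ i)) (ℓ : ℕ) :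
    cconjHom (theta m μ X ℓ) = theta m μ X ℓ := by
  rw [map_theta, cconjHom_X]
  conv_rhs => rw [← theta_comp_perm τ]
  simp only [cconjHom_apply, hτμ, hτm]

section Transpose

variable {ι U : Type*} [Fintype ι] [DecidableEq ι] [Ring U] [Algebra Ct U]

/-- The twisted conjugate transpose of matrices over `Uᵐᵒᵖ` attached to an anti-endomorphism `σ`
of `U` and signs `ε`. -/
def signedTranspose (σ : U →+* Uᵐᵒᵖ) (ε : ι → Ct) (hε : ∀ i, ε i * ε i = 1) :
    Matrix ι ι Uᵐᵒᵖ →+* (Matrix ι ι Uᵐᵒᵖ)ᵐᵒᵖ where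
  toFun A := op (Matrix.of fun i j => (ε i * ε j) • σ (unop (A j i)))
  map_one' := by
    rw [← op_one]
    congr 1
    ext1 i j
    by_cases h : i = j
    · subst h
      simp [hε]
    · simp [Matrix.one_apply, h, Ne.symm h]
  map_zero' := by
    rw [← op_zero]
    congr 1
    ext1 i j
    simp
  map_add' A B := by
    rw [← op_add]
    congr 1
    ext1 i j
    simp [smul_add]
  map_mul' A B := by
    rw [← op_mul]
    congr 1
    ext1 i j
    simp only [Matrix.of_apply, Matrix.mul_apply, Finset.unop_sum, unop_mul, map_sum, map_mul,
      Finset.smul_sum]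
    refine Finset.sum_congr rfl fun a _ => ?_
    rw [smul_mul_smul_comm]
    congr 1
    linear_combination (-(ε i * ε j)) * hε a

lemma unop_signedTranspose_apply (σ : U →+* Uᵐᵒᵖ) (ε : ι → Ct) (hε : ∀ i, ε i * ε i = 1)
    (A : Matrix ι ι Uᵐᵒᵖ) (i j : ι) :
    unop (signedTranspose σ ε hε A) i j = (ε i * ε j) • σ (unop (A j i)) := rfl

lemma signedTranspose_algebraMap (σ : U →+* Uᵐᵒᵖ) (ε : ι → Ct) (hε : ∀ i, ε i * ε i = 1)
    (hσ : ∀ a : Ct, σ (algebraMap Ct U a) = op (algebraMap Ct U (cconjHom a))) (a : Ct) :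
    signedTranspose σ ε hε (algebraMap Ct (Matrix ι ι Uᵐᵒᵖ) a) =
      op (algebraMap Ct (Matrix ι ι Uᵐᵒᵖ) (cconjHom a)) := by
  apply unop_injective
  ext1 i j
  rw [unop_signedTranspose_apply, unop_op]
  by_cases h : i = j
  · subst h
    simp [Matrix.algebraMap_matrix_apply, hε, hσ]
  · simp [Matrix.algebraMap_matrix_apply, h, Ne.symm h]

lemma signedTranspose_prod (σ : U →+* Uᵐᵒᵖ) (ε : ι → Ct) (hε : ∀ i, ε i * ε i = 1)
    (hσ : ∀ a : Ct, σ (algebraMap Ct U a) = op (algebraMap Ct U (cconjHom a)))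
    (A : Matrix ι ι Uᵐᵒᵖ) (hA : signedTranspose σ ε hε A = op A) {k : ℕ} (μ : Fin k → Ct)
    (τ : Equiv.Perm (Fin k)) (hτμ : ∀ i, cconj (μ i) = μ (τ i)) :
    signedTranspose σ ε hε
        (List.ofFn fun s : Fin k => A - algebraMap Ct (Matrix ι ι Uᵐᵒᵖ) (μ s)).prod =
      op (List.ofFn fun s : Fin k => A - algebraMap Ct (Matrix ι ι Uᵐᵒᵖ) (μ s)).prod := by
  have hc : ∀ a b : Ct, Commute (A - algebraMap Ct (Matrix ι ι Uᵐᵒᵖ) a)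
      (A - algebraMap Ct (Matrix ι ι Uᵐᵒᵖ) b) := fun a b =>
    ((Commute.refl A).sub_right (Algebra.commute_algebraMap_right b A)).sub_left
      ((Algebra.commute_algebraMap_left a _).sub_right (Algebra.commute_algebraMap_left a _))
  apply unop_injective
  rw [unop_map_list_prod, unop_op, List.map_ofFn]
  have hfun : ((unop ∘ signedTranspose σ ε hε) ∘
      fun s : Fin k => A - algebraMap Ct (Matrix ι ι Uᵐᵒᵖ) (μ s)) =
      (fun s : Fin k => A - algebraMap Ct (Matrix ι ι Uᵐᵒᵖ) (μ s)) ∘ τ := by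
    funext s
    simp only [Function.comp_apply, map_sub, hA, signedTranspose_algebraMap σ ε hε hσ, unop_sub,
      unop_op, cconjHom_apply, hτμ]
  rw [hfun]
  refine List.Perm.prod_eq' ((List.reverse_perm _).trans (Equiv.Perm.ofFn_comp_perm τ _)) ?_
  rw [List.pairwise_reverse, List.pairwise_ofFn]
  intro i j _
  exact hc _ _

lemma map_unop_trace_of_signedTranspose (σ : U →+* Uᵐᵒᵖ) (ε : ι → Ct) (hε : ∀ i, ε i * ε i = 1)
    (A : Matrix ι ι Uᵐᵒᵖ) (hA : signedTranspose σ ε hε A = op A) :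
    σ (unop A.trace) = op (unop A.trace) := by
  rw [op_unop]
  simp only [Matrix.trace, Matrix.diag_apply, Finset.unop_sum, map_sum]
  refine Finset.sum_congr rfl fun i _ => ?_
  have h : (ε i * ε i) • σ (unop (A i i)) = A i i := congrFun (congrFun (congrArg unop hA) i) i
  rwa [hε, one_smul] at h

lemma map_unop_trace_pow_of_signedTranspose (σ : U →+* Uᵐᵒᵖ) (ε : ι → Ct)
    (hε : ∀ i, ε i * ε i = 1) (A : Matrix ι ι Uᵐᵒᵖ) (hA : signedTranspose σ ε hε A = op A) (ℓ : ℕ) :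
    σ (unop (A ^ ℓ).trace) = op (unop (A ^ ℓ).trace) :=
  map_unop_trace_of_signedTranspose σ ε hε _ (by rw [map_pow, hA, op_pow])

end Transpose

lemma Egen_mul_sub (n : ℕ) (i j l m : Fin n) :
    Egen n i j * Egen n m l - Egen n m l * Egen n i j =
      (X : Ct) • ((if j = m then (1 : Ct) else 0) • Egen n i l -
        (if i = l then (1 : Ct) else 0) • Egen n m j) := by
  have h := RingQuot.mkAlgHom_rel Ct (glRel.comm i j l m)
  simpa only [map_sub, map_mul, map_smul, Egen] using h

/-- Ring homomorphisms out of `U(g_t)`, semilinear along any central `ℂ[t] → R`. -/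
lemma exists_ringHom_Ugt (n : ℕ) {R : Type*} [Ring R] (f : Ct →+* R)
    (hf : ∀ a x, f a * x = x * f a) (g : Fin n → Fin n → R)
    (hg : ∀ i j l m, g i j * g m l - g m l * g i j =
      f X * (f (if j = m then 1 else 0) * g i l - f (if i = l then 1 else 0) * g m j)) :
    ∃ φ : Ugt n →+* R, (∀ a, φ (algebraMap Ct (Ugt n) a) = f a) ∧
      ∀ i j, φ (Egen n i j) = g i j := by
  let _ : Algebra Ct R := f.toAlgebra' hf
  have hsmul : ∀ (a : Ct) (x : R), a • x = f a * x := fun a x => Algebra.smul_def a x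
  let φ0 : FA n →ₐ[Ct] R := FreeAlgebra.lift Ct fun p : Fin n × Fin n => g p.1 p.2
  have hφ0 : ∀ ⦃x y⦄, glRel n x y → φ0 x = φ0 y := by
    rintro _ _ ⟨i, j, l, m⟩
    simp only [φ0, map_sub, map_mul, map_smul, FreeAlgebra.lift_ι_apply, hsmul]
    exact hg i j l m
  let φ := RingQuot.liftAlgHom Ct ⟨φ0, hφ0⟩
  refine ⟨φ.toRingHom, fun a => φ.commutes a, fun i j => ?_⟩
  have : φ (Egen n i j) = φ0 (FreeAlgebra.ι Ct (i, j)) :=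
    RingQuot.liftAlgHom_mkAlgHom_apply Ct φ0 hφ0 _
  exact this.trans (FreeAlgebra.lift_ι_apply _ _)

lemma ringHom_Ugt_ext (n : ℕ) {R : Type*} [Semiring R] (f g : Ugt n →+* R)
    (h1 : ∀ a, f (algebraMap Ct (Ugt n) a) = g (algebraMap Ct (Ugt n) a))
    (h2 : ∀ i j, f (Egen n i j) = g (Egen n i j)) (u : Ugt n) : f u = g u := by
  obtain ⟨a, rfl⟩ := RingQuot.mkAlgHom_surjective Ct (glRel n) u
  induction a using FreeAlgebra.induction with
  | grade0 r => simpa only [AlgHom.commutes] using h1 r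
  | grade1 x => exact h2 x.1 x.2
  | mul a b ha hb => rw [map_mul, map_mul, map_mul, ha, hb]
  | add a b ha hb => rw [map_add, map_add, map_add, ha, hb]

lemma signed_commutator {ι U : Type*} [DecidableEq ι] [Ring U] [Algebra Ct U] (E : ι → ι → U)
    (hE : ∀ i j l m, E i j * E m l - E m l * E i j =
      (X : Ct) • ((if j = m then (1 : Ct) else 0) • E i l - (if i = l then (1 : Ct) else 0) • E m j))
    (ε : ι → Ct) (hε : ∀ i, ε i * ε i = 1) (i j l m : ι) :
    op ((ε i * ε j) • E j i) * op ((ε m * ε l) • E l m) -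
        op ((ε m * ε l) • E l m) * op ((ε i * ε j) • E j i) =
      (X : Ct) • ((if j = m then (1 : Ct) else 0) • op ((ε i * ε l) • E l i) -
        (if i = l then (1 : Ct) else 0) • op ((ε m * ε j) • E j m)) := by
  simp only [← op_mul, ← op_sub, ← op_smul]
  congr 1
  simp only [smul_mul_smul_comm]
  rw [mul_comm (ε m * ε l), ← smul_sub, hE]
  simp only [smul_sub, smul_smul]
  congr 2
  · by_cases h : j = m
    · subst h
      simp only [if_true]
      linear_combination X * ε i * ε l * hε j
    · simp [h, Ne.symm h]
  · by_cases h : i = l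
    · subst h
      simp only [if_true]
      linear_combination X * ε m * ε j * hε i
    · simp [h, Ne.symm h]

lemma exists_antihom_Ugt (n : ℕ) (ε : Fin n → Ct) (hε : ∀ i, ε i * ε i = 1) :
    ∃ σ : Ugt n →+* (Ugt n)ᵐᵒᵖ,
      (∀ a, σ (algebraMap Ct (Ugt n) a) = op (algebraMap Ct (Ugt n) (cconjHom a))) ∧
      ∀ i j, σ (Egen n i j) = op ((ε i * ε j) • Egen n j i) := by
  refine exists_ringHom_Ugt n ((algebraMap Ct (Ugt n)ᵐᵒᵖ).comp cconjHom)
    (fun a x => Algebra.commutes (R := Ct) (A := (Ugt n)ᵐᵒᵖ) (cconjHom a) x)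
    (fun i j => op ((ε i * ε j) • Egen n j i)) fun i j l m => ?_
  simp only [RingHom.comp_apply, ← Algebra.smul_def, cconjHom_X, apply_ite cconjHom, map_one,
    map_zero]
  exact signed_commutator (Egen n) (Egen_mul_sub n) ε hε i j l m

lemma antihom_involutive (n : ℕ) (ε : Fin n → Ct) (hε : ∀ i, ε i * ε i = 1)
    (σ : Ugt n →+* (Ugt n)ᵐᵒᵖ)
    (hσ : ∀ a, σ (algebraMap Ct (Ugt n) a) = op (algebraMap Ct (Ugt n) (cconjHom a)))
    (hσE : ∀ i j, σ (Egen n i j) = op ((ε i * ε j) • Egen n j i))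
    (hεc : ∀ i, cconjHom (ε i) = ε i) (u : Ugt n) :
    unop (σ (unop (σ u))) = u := by
  have key := ringHom_Ugt_ext n
    (((RingEquiv.opOp (Ugt n)).symm : (Ugt n)ᵐᵒᵖᵐᵒᵖ →+* Ugt n).comp ((RingHom.op σ).comp σ))
    (RingHom.id (Ugt n)) ?_ ?_ u
  · exact key
  · intro a
    change unop (σ (unop (σ (algebraMap Ct (Ugt n) a)))) = algebraMap Ct (Ugt n) a
    rw [hσ, unop_op, hσ, unop_op, cconjHom_cconjHom]
  · intro i j
    change unop (σ (unop (σ (Egen n i j)))) = Egen n i j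
    rw [hσE, unop_op, Algebra.smul_def, map_mul, hσ, hσE, unop_mul, unop_op, unop_op,
      ← Algebra.commutes, ← Algebra.smul_def, smul_smul, map_mul, hεc, hεc]
    rw [show ε i * ε j * (ε j * ε i) = 1 by linear_combination ε i * ε i * hε j + hε i, one_smul]

/-- The signed transpose anti-involution fixes the matrix `E`. -/
lemma signedTranspose_EmatOp (n : ℕ) (ε : Fin n → Ct) (hε : ∀ i, ε i * ε i = 1)
    (σ : Ugt n →+* (Ugt n)ᵐᵒᵖ) (hσE : ∀ i j, σ (Egen n i j) = op ((ε i * ε j) • Egen n j i)) :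
    signedTranspose σ ε hε (EmatOp n) = op (EmatOp n) := by
  apply unop_injective
  ext1 i j
  change (ε i * ε j) • σ (Egen n j i) = op (Egen n i j)
  rw [hσE, ← op_smul, smul_smul]
  rw [show ε i * ε j * (ε j * ε i) = 1 by linear_combination ε i * ε i * hε j + hε i, one_smul]

lemma clsA_eq_zero {n k : ℕ} {m : Fin k → ℕ} {μ : Fin k → Ct} {u : Ugt n}
    (hu : u ∈ genSetA n k m μ) : clsA n k m μ u = 0 := by
  have h := RingQuot.mkAlgHom_rel Ct (s := fun a b : Ugt n => a - b ∈ genSetA n k m μ)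
    (x := u) (y := 0) (Set.mem_of_eq_of_mem (sub_zero u) hu)
  exact h.trans (map_zero _)

lemma clsA_unop_antihom (n k : ℕ) (m : Fin k → ℕ) (μ : Fin k → Ct) (τ : Equiv.Perm (Fin k))
    (hτm : ∀ i, m (τ i) = m i) (hτμ : ∀ i, cconj (μ i) = μ (τ i))
    (ε : Fin n → Ct) (hε : ∀ i, ε i * ε i = 1) (σ : Ugt n →+* (Ugt n)ᵐᵒᵖ)
    (hσ : ∀ a, σ (algebraMap Ct (Ugt n) a) = op (algebraMap Ct (Ugt n) (cconjHom a)))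
    (hσE : ∀ i j, σ (Egen n i j) = op ((ε i * ε j) • Egen n j i))
    (u : Ugt n) (hu : u ∈ genSetA n k m μ) : clsA n k m μ (unop (σ u)) = 0 := by
  have hE := signedTranspose_EmatOp n ε hε σ hσE
  rcases hu with ⟨i, j, rfl⟩ | ⟨ℓ, hℓ, rfl⟩
  · have h := congrFun (congrFun (congrArg unop
      (signedTranspose_prod σ ε hε hσ (EmatOp n) hE μ τ hτμ)) j) i
    have h' : (ε j * ε i) • unop (σ (prodE n k μ i j)) = prodE n k μ j i := congrArg unop h
    have h2 : unop (σ (prodE n k μ i j)) = (ε i * ε j) • prodE n k μ j i := by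
      rw [← h', smul_smul,
        show ε i * ε j * (ε j * ε i) = 1 by linear_combination ε i * ε i * hε j + hε i, one_smul]
    have h3 := clsA_eq_zero (m := m) (Or.inl ⟨j, i, rfl⟩ : prodE n k μ j i ∈ genSetA n k m μ)
    rw [h2]
    refine (map_smul (RingQuot.mkAlgHom Ct fun a b : Ugt n => a - b ∈ genSetA n k m μ) _ _).trans ?_
    exact (congrArg _ h3).trans (smul_zero _)
  · have htr : σ (trE n ℓ) = op (trE n ℓ) :=
      map_unop_trace_pow_of_signedTranspose σ ε hε (EmatOp n) hE ℓ
    have h : unop (σ (trE n ℓ - algebraMap Ct (Ugt n) (theta m μ X ℓ))) =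
        trE n ℓ - algebraMap Ct (Ugt n) (theta m μ X ℓ) := by
      refine (congrArg unop (map_sub σ _ _)).trans ?_
      rw [hσ, htr, cconjHom_theta m μ τ hτm hτμ]
      rfl
    rw [h]
    exact clsA_eq_zero (Or.inr ⟨ℓ, hℓ, rfl⟩)

/-- An anti-involution of `U(g_t)` killing the defining ideal of `A_{m,μ,t}` descends to a
`*`-structure. -/
lemma exists_star_AlgA (n k : ℕ) (m : Fin k → ℕ) (μ : Fin k → Ct) (σ : Ugt n →+* (Ugt n)ᵐᵒᵖ)
    (hσ : ∀ a, σ (algebraMap Ct (Ugt n) a) = op (algebraMap Ct (Ugt n) (cconjHom a)))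
    (hinv : ∀ u, unop (σ (unop (σ u))) = u)
    (hker : ∀ u ∈ genSetA n k m μ, clsA n k m μ (unop (σ u)) = 0) :
    ∃ st : AlgA n k m μ → AlgA n k m μ, IsStarStructure st ∧
      ∀ u, st (clsA n k m μ u) = clsA n k m μ (unop (σ u)) := by
  let r : Ugt n → Ugt n → Prop := fun a b => a - b ∈ genSetA n k m μ
  let π : Ugt n →ₐ[Ct] AlgA n k m μ := RingQuot.mkAlgHom Ct r
  have hπ : Function.Surjective π := RingQuot.mkAlgHom_surjective Ct r
  let φ0 : Ugt n →+* (AlgA n k m μ)ᵐᵒᵖ := (RingHom.op (π : Ugt n →+* AlgA n k m μ)).comp σ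
  have hφ0 : ∀ ⦃a b⦄, r a b → φ0 a = φ0 b := by
    intro a b hab
    have h : π (unop (σ (a - b))) = 0 := hker _ hab
    have h' : π (unop (σ (a - b))) = π (unop (σ a)) - π (unop (σ b)) :=
      (congrArg (fun x => π (unop x)) (map_sub σ a b)).trans (map_sub π _ _)
    exact congrArg op (sub_eq_zero.mp (h'.symm.trans h))
  let φ : AlgA n k m μ →+* (AlgA n k m μ)ᵐᵒᵖ := RingQuot.lift ⟨φ0, hφ0⟩
  have hφ : ∀ u, unop (φ (π u)) = π (unop (σ u)) := by
    intro u
    have h : φ (RingQuot.mkRingHom r u) = φ0 u := RingQuot.lift_mkRingHom_apply φ0 hφ0 u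
    rw [← RingQuot.mkAlgHom_coe Ct r] at h
    exact congrArg unop h
  refine ⟨fun x => unop (φ x), ⟨fun u v => ?_, fun f u => ?_, fun u v => ?_, ?_, fun u => ?_⟩, hφ⟩
  · simp
  · obtain ⟨u, rfl⟩ := hπ u
    change unop (φ (f • π u)) = cconjHom f • unop (φ (π u))
    rw [← map_smul, hφ, hφ, Algebra.smul_def, map_mul, hσ, unop_mul, unop_op, ← Algebra.commutes,
      ← Algebra.smul_def, map_smul]
  · simp
  · simp
  · obtain ⟨u, rfl⟩ := hπ u
    change unop (φ (unop (φ (π u)))) = π u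
    rw [hφ, hφ, hinv]

/-- the `u(r,s)`-compatible real form of the quantum orbit. -/
theorem statement11 (n k : ℕ) (hn : 1 ≤ n) (hk : 1 ≤ k) (hkn : k ≤ n)
    (m : Fin k → ℕ) (hm : ∀ i, 0 < m i) (hsum : ∑ i, m i = n)
    (r s : ℕ) (hrs : r + s = n)
    (μ : Fin k → Ct) (τ : Equiv.Perm (Fin k))
    (hτm : ∀ i, m (τ i) = m i) (hτμ : ∀ i, cconj (μ i) = μ (τ i)) :
    ∃ st : AlgA n k m μ → AlgA n k m μ, IsStarStructure st ∧
      ∀ i j : Fin n,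
        st (clsA n k m μ (Egen n i j)) =
          ((if (i : ℕ) < r then (1 : Ct) else -1) * (if (j : ℕ) < r then 1 else -1)) •
            clsA n k m μ (Egen n j i) := by
  let ε : Fin n → Ct := fun i => if (i : ℕ) < r then 1 else -1
  have hε : ∀ i, ε i * ε i = 1 := fun i => by
    dsimp only [ε]
    split_ifs <;> simp
  have hεc : ∀ i, cconjHom (ε i) = ε i := fun i => by
    dsimp only [ε]
    split_ifs <;> simp
  obtain ⟨σ, hσ, hσE⟩ := exists_antihom_Ugt n ε hε
  obtain ⟨st, hst, hcls⟩ := exists_star_AlgA n k m μ σ hσ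
    (antihom_involutive n ε hε σ hσ hσE hεc)
    (clsA_unop_antihom n k m μ τ hτm hτμ ε hε σ hσ hσE)
  refine ⟨st, hst, fun i j => ?_⟩
  rw [hcls, hσE, unop_op]
  exact map_smul (RingQuot.mkAlgHom Ct fun a b : Ugt n => a - b ∈ genSetA n k m μ) _ _

end
end

section
/- Let k ≥ 2, ν, μ ∈ ℂ^k, ω ∈ ℂ, and write ν' = (ν₁,…,ν_{k−1}), μ' = (μ₁,…,μ_{k−1}). Then for every integer ℓ ≥ 1: θ̃_ℓ(ν,μ,ω) = θ̃_ℓ(ν',μ',ω) + ν_k·ω·Σ_{i=1}^{ℓ−1} θ̃_{ℓ−i}(ν',μ',ω)·μ_k^i + ν_k·μ_k^ℓ. -/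
noncomputable section

/-- `θ̃_ℓ(ν,μ,ω)`: the inner sum ranges over tuples of *positive* integers summing to `ℓ`. -/
def thetaT {k : ℕ} (ν μ : Fin k → ℂ) (ω : ℂ) (ℓ : ℕ) : ℂ :=
  ∑ s ∈ Finset.Icc 1 k,
    ω ^ (s - 1) *
      ∑ J ∈ Finset.powersetCard s (Finset.univ : Finset (Fin k)),
        (∏ j ∈ J, ν j) *
          ∑ d ∈ (J.finsuppAntidiag ℓ).filter (fun d => ∀ j ∈ J, 1 ≤ d j),
            ∏ j ∈ J, μ j ^ d j

/-- `C̃_j(ν,μ,ω)` (for `μ` with pairwise distinct coordinates). -/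
def Ctil {k : ℕ} (ν μ : Fin k → ℂ) (ω : ℂ) (j : Fin k) : ℂ :=
  ν j + ν j *
    ∑ p ∈ Finset.Icc 1 (k - 1),
      ω ^ p *
        ∑ I ∈ Finset.powersetCard p (Finset.univ.erase j),
          ∏ i ∈ I, (ν i * μ i / (μ j - μ i))

/-- The generating series `∑_{n ≥ 1} μⁿ Xⁿ`. -/
def posGeomSeries (μ : ℂ) : PowerSeries ℂ :=
  PowerSeries.mk fun n => if 1 ≤ n then μ ^ n else 0

/-- The sum of `ω ^ (#J - 1) * ∏ j ∈ J, f j` over the nonempty subsets `J` of `S`. -/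
def nonemptySubsetSum {ι R : Type*} [CommSemiring R] (ω : R) (f : ι → R) (S : Finset ι) : R :=
  ∑ J ∈ S.powerset, if J.Nonempty then ω ^ (J.card - 1) * ∏ j ∈ J, f j else 0

lemma nonemptySubsetSum_eq_sum_powersetCard {ι R : Type*} [CommSemiring R] (ω : R) (f : ι → R)
    (S : Finset ι) :
    nonemptySubsetSum ω f S = ∑ s ∈ Finset.Icc 1 S.card,
      ω ^ (s - 1) * ∑ J ∈ Finset.powersetCard s S, ∏ j ∈ J, f j := by
  rw [nonemptySubsetSum, Finset.sum_powerset, Finset.range_eq_Ico,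
    Finset.sum_eq_sum_Ico_succ_bot (Nat.succ_pos _)]
  rw [Finset.powersetCard_zero, Finset.sum_singleton, if_neg (by simp), zero_add]
  refine Finset.sum_congr (by ext; simp) fun s hs => ?_
  rw [Finset.mul_sum]
  refine Finset.sum_congr rfl fun J hJ => ?_
  have hcard := (Finset.mem_powersetCard.mp hJ).2
  have hpos := (Finset.mem_Icc.mp hs).1
  rw [if_pos (Finset.card_pos.mp (by omega)), hcard]

lemma nonemptySubsetSum_insert {ι R : Type*} [DecidableEq ι] [CommSemiring R] (ω : R) (f : ι → R)
    {S : Finset ι} {a : ι} (ha : a ∉ S) :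
    nonemptySubsetSum ω f (insert a S) =
      nonemptySubsetSum ω f S + f a * (1 + ω * nonemptySubsetSum ω f S) := by
  have key : ∑ t ∈ S.powerset, ω ^ t.card * ∏ j ∈ t, f j = 1 + ω * nonemptySubsetSum ω f S := by
    have hone : (1 : R) = ∑ t ∈ S.powerset, if t = ∅ then 1 else 0 := by simp
    rw [hone, nonemptySubsetSum, Finset.mul_sum, ← Finset.sum_add_distrib]
    refine Finset.sum_congr rfl fun t _ => ?_
    rcases t.eq_empty_or_nonempty with rfl | ht
    · simp
    · rw [if_neg ht.ne_empty, if_pos ht, zero_add, ← mul_assoc, ← pow_succ',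
        Nat.sub_add_cancel ht.card_pos]
  rw [← key, nonemptySubsetSum, Finset.sum_powerset_insert ha, ← nonemptySubsetSum,
    Finset.mul_sum]
  congr 1
  refine Finset.sum_congr rfl fun t ht => ?_
  have hat : a ∉ t := fun h => ha (Finset.mem_powerset.mp ht h)
  rw [if_pos (Finset.insert_nonempty a t), Finset.card_insert_of_notMem hat,
    Finset.prod_insert hat, Nat.add_sub_cancel]
  ring

lemma nonemptySubsetSum_map {ι κ R : Type*} [CommSemiring R] (ω : R) (e : κ ↪ ι)
    (f : ι → R) (S : Finset κ) :
    nonemptySubsetSum ω f (S.map e) = nonemptySubsetSum ω (fun i => f (e i)) S := by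
  simp [nonemptySubsetSum_eq_sum_powersetCard, Finset.powersetCard_map]

lemma nonemptySubsetSum_fin_succ {R : Type*} [CommSemiring R] {n : ℕ} (ω : R)
    (f : Fin (n + 1) → R) :
    nonemptySubsetSum ω f Finset.univ =
      nonemptySubsetSum ω (fun i : Fin n => f i.castSucc) Finset.univ +
        f (Fin.last n) *
          (1 + ω * nonemptySubsetSum ω (fun i : Fin n => f i.castSucc) Finset.univ) := by
  rw [Fin.univ_castSuccEmb, Finset.cons_eq_insert, nonemptySubsetSum_insert _ _ (by simp),
    nonemptySubsetSum_map]
  rfl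

lemma coeff_prod_posGeomSeries {k : ℕ} (μ : Fin k → ℂ) (J : Finset (Fin k)) (ℓ : ℕ) :
    PowerSeries.coeff ℓ (∏ j ∈ J, posGeomSeries (μ j)) =
      ∑ d ∈ (J.finsuppAntidiag ℓ).filter (fun d => ∀ j ∈ J, 1 ≤ d j), ∏ j ∈ J, μ j ^ d j := by
  rw [PowerSeries.coeff_prod, Finset.sum_filter]
  refine Finset.sum_congr rfl fun d _ => ?_
  simp only [posGeomSeries, PowerSeries.coeff_mk, Finset.prod_ite_zero]
  congr

/-- The generating series of `ℓ ↦ thetaT ν μ ω ℓ`. -/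
def thetaSeries {k : ℕ} (ν μ : Fin k → ℂ) (ω : ℂ) : PowerSeries ℂ :=
  nonemptySubsetSum (PowerSeries.C ω) (fun j => PowerSeries.C (ν j) * posGeomSeries (μ j))
    Finset.univ

lemma coeff_thetaSeries {k : ℕ} (ν μ : Fin k → ℂ) (ω : ℂ) (ℓ : ℕ) :
    PowerSeries.coeff ℓ (thetaSeries ν μ ω) = thetaT ν μ ω ℓ := by
  rw [thetaSeries, nonemptySubsetSum_eq_sum_powersetCard, thetaT, map_sum, Finset.card_univ,
    Fintype.card_fin]
  refine Finset.sum_congr rfl fun s _ => ?_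
  rw [← map_pow, PowerSeries.coeff_C_mul, map_sum]
  congr 1
  refine Finset.sum_congr rfl fun J _ => ?_
  rw [Finset.prod_mul_distrib, ← map_prod, PowerSeries.coeff_C_mul, coeff_prod_posGeomSeries]

lemma thetaT_zero {k : ℕ} (ν μ : Fin k → ℂ) (ω : ℂ) : thetaT ν μ ω 0 = 0 := by
  rw [thetaT]
  refine Finset.sum_eq_zero fun s hs => mul_eq_zero_of_right _ (Finset.sum_eq_zero fun J hJ => ?_)
  have hcard := (Finset.mem_powersetCard.mp hJ).2
  have hpos := (Finset.mem_Icc.mp hs).1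
  obtain ⟨j, hj⟩ := Finset.card_pos.mp (show 0 < J.card by omega)
  rw [← coeff_prod_posGeomSeries, PowerSeries.coeff_zero_eq_constantCoeff_apply, map_prod]
  refine mul_eq_zero_of_right _ (Finset.prod_eq_zero hj ?_)
  simp [posGeomSeries, ← PowerSeries.coeff_zero_eq_constantCoeff_apply]

lemma coeff_posGeomSeries_mul_thetaSeries {k : ℕ} (ν μ : Fin k → ℂ) (ω m : ℂ) {ℓ : ℕ}
    (hℓ : 1 ≤ ℓ) :
    PowerSeries.coeff ℓ (posGeomSeries m * thetaSeries ν μ ω) =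
      ∑ i ∈ Finset.Icc 1 (ℓ - 1), thetaT ν μ ω (ℓ - i) * m ^ i := by
  rw [PowerSeries.coeff_mul, Finset.Nat.sum_antidiagonal_eq_sum_range_succ_mk]
  symm
  refine Finset.sum_subset_zero_on_sdiff (fun i hi => ?_) (fun i hi => ?_) fun i hi => ?_
  · simp only [Finset.mem_Icc, Finset.mem_range] at hi ⊢
    omega
  · simp only [Finset.mem_sdiff, Finset.mem_Icc, Finset.mem_range] at hi
    obtain rfl | rfl : i = 0 ∨ i = ℓ := by omega
    · simp [posGeomSeries]
    · simp [coeff_thetaSeries, thetaT_zero]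
  · simp [posGeomSeries, coeff_thetaSeries, (Finset.mem_Icc.mp hi).1, mul_comm]

/-- the recurrence for `θ̃_ℓ` in terms of the first `k−1` variables. -/
theorem statement15 (k : ℕ) (hk : 2 ≤ k) (ν μ : Fin k → ℂ) (ω : ℂ) (ℓ : ℕ) (hℓ : 1 ≤ ℓ) :
    thetaT ν μ ω ℓ =
      thetaT (fun i : Fin (k - 1) => ν (Fin.castLE (Nat.sub_le k 1) i))
          (fun i : Fin (k - 1) => μ (Fin.castLE (Nat.sub_le k 1) i)) ω ℓ
        + ν ⟨k - 1, by omega⟩ * ω *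
            ∑ i ∈ Finset.Icc 1 (ℓ - 1),
              thetaT (fun i : Fin (k - 1) => ν (Fin.castLE (Nat.sub_le k 1) i))
                  (fun i : Fin (k - 1) => μ (Fin.castLE (Nat.sub_le k 1) i)) ω (ℓ - i) *
                μ ⟨k - 1, by omega⟩ ^ i
        + ν ⟨k - 1, by omega⟩ * μ ⟨k - 1, by omega⟩ ^ ℓ := by
  obtain ⟨n, rfl⟩ : ∃ n, k = n + 1 := ⟨k - 1, by omega⟩
  change thetaT ν μ ω ℓ =
    thetaT (fun i : Fin n => ν i.castSucc) (fun i : Fin n => μ i.castSucc) ω ℓ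
      + ν (Fin.last n) * ω *
          ∑ i ∈ Finset.Icc 1 (ℓ - 1),
            thetaT (fun i : Fin n => ν i.castSucc) (fun i : Fin n => μ i.castSucc) ω (ℓ - i) *
              μ (Fin.last n) ^ i
      + ν (Fin.last n) * μ (Fin.last n) ^ ℓ
  have hrec : thetaSeries ν μ ω =
      thetaSeries (fun i : Fin n => ν i.castSucc) (fun i : Fin n => μ i.castSucc) ω
        + PowerSeries.C (ν (Fin.last n) * ω) * (posGeomSeries (μ (Fin.last n)) *
            thetaSeries (fun i : Fin n => ν i.castSucc) (fun i : Fin n => μ i.castSucc) ω)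
        + PowerSeries.C (ν (Fin.last n)) * posGeomSeries (μ (Fin.last n)) := by
    simp only [thetaSeries, map_mul]
    rw [nonemptySubsetSum_fin_succ]
    ring
  rw [← coeff_thetaSeries ν, hrec, map_add, map_add, PowerSeries.coeff_C_mul,
    PowerSeries.coeff_C_mul, coeff_posGeomSeries_mul_thetaSeries _ _ _ _ hℓ, coeff_thetaSeries]
  simp [posGeomSeries, hℓ]

end
end

section
/- Let k ≥ 1, ν ∈ ℂ^k, ω ∈ ℂ, and let μ ∈ ℂ^k have pairwise distinct coordinates. Then for every integer ℓ ≥ 1: θ̃_ℓ(ν,μ,ω) = Σ_{j=1}^{k} μ_j^ℓ · C̃_j(ν,μ,ω). -/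
noncomputable section

/-- The power series `∑_{d ≥ 1} (m X)^d`. -/
def posGeom {K : Type*} [Field K] (m : K) : PowerSeries K :=
  PowerSeries.mk fun d => if d = 0 then 0 else m ^ d

lemma posGeom_eq {K : Type*} [Field K] (m : K) :
    posGeom m = PowerSeries.C m * PowerSeries.X * (1 + posGeom m) := by
  ext n
  rw [mul_assoc, PowerSeries.coeff_C_mul]
  cases n with
  | zero => simp [posGeom]
  | succ n =>
    rw [mul_comm PowerSeries.X, PowerSeries.coeff_succ_mul_X]
    cases n with
    | zero => simp [posGeom]
    | succ n => simp [posGeom, PowerSeries.coeff_one, pow_succ']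

lemma coeff_prod_posGeom {K ι : Type*} [Field K] [DecidableEq ι] (μ : ι → K)
    (J : Finset ι) (n : ℕ) [DecidablePred fun d : ι →₀ ℕ => ∀ j ∈ J, 1 ≤ d j] :
    PowerSeries.coeff n (∏ j ∈ J, posGeom (μ j)) =
      ∑ d ∈ (J.finsuppAntidiag n).filter (fun d => ∀ j ∈ J, 1 ≤ d j), ∏ j ∈ J, μ j ^ d j := by
  rw [PowerSeries.coeff_prod, Finset.sum_filter]
  refine Finset.sum_congr rfl fun d _ => ?_
  split_ifs with h
  · refine Finset.prod_congr rfl fun j hj => ?_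
    have := h j hj
    simp [posGeom, show d j ≠ 0 by omega]
  · push Not at h
    obtain ⟨j, hj, hd⟩ := h
    exact Finset.prod_eq_zero hj (by simp [posGeom, show d j = 0 by omega])

lemma coeff_succ_posGeom_mul {K : Type*} [Field K] (m : K) (Q : PowerSeries K) (n : ℕ) :
    PowerSeries.coeff (n + 1) (posGeom m * Q) =
      m * (PowerSeries.coeff n Q + PowerSeries.coeff n (posGeom m * Q)) := by
  have h : posGeom m * Q = PowerSeries.C m * ((Q + posGeom m * Q) * PowerSeries.X) := by
    nth_rewrite 1 [posGeom_eq m]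
    ring
  nth_rewrite 1 [h]
  rw [PowerSeries.coeff_C_mul, PowerSeries.coeff_succ_mul_X, map_add]

lemma constantCoeff_posGeom {K : Type*} [Field K] (m : K) :
    PowerSeries.coeff 0 (posGeom m) = 0 := by
  simp [posGeom]

lemma sum_mul_prod_div_sub_eq_zero {K ι : Type*} [Field K] [DecidableEq ι] (μ : ι → K)
    (J : Finset ι) (hJ : 2 ≤ J.card) (hμ : Set.InjOn μ J) :
    ∑ j ∈ J, μ j * ∏ i ∈ J.erase j, μ i / (μ j - μ i) = 0 := by
  have h := Lagrange.coeff_eq_sum hμ (P := Polynomial.C (∏ i ∈ J, μ i))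
    (Polynomial.degree_C_le.trans_lt (by exact_mod_cast (by omega : 0 < J.card)))
  rw [Polynomial.coeff_C, if_neg (by omega)] at h
  rw [h]
  refine Finset.sum_congr rfl fun j hj => ?_
  rw [Polynomial.eval_C, Finset.prod_div_distrib, ← Finset.mul_prod_erase J μ hj, mul_div_assoc]

/-- Partial fraction expansion of `∏_{j ∈ J} μ_j X / (1 - μ_j X)`, read off on coefficients. -/
lemma coeff_succ_prod_posGeom {K ι : Type*} [Field K] [DecidableEq ι] (μ : ι → K)
    (J : Finset ι) (hJ : J.Nonempty) (hμ : Set.InjOn μ J) (n : ℕ) :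
    PowerSeries.coeff (n + 1) (∏ j ∈ J, posGeom (μ j)) =
      ∑ j ∈ J, μ j ^ (n + 1) * ∏ i ∈ J.erase j, μ i / (μ j - μ i) := by
  induction hJ using Finset.Nonempty.cons_induction generalizing n with
  | singleton a => simp [posGeom]
  | cons a s ha hs ih =>
    rw [Finset.cons_eq_insert] at hμ ⊢
    have ih' := ih (hμ.mono (by simp))
    rw [Finset.prod_insert ha]
    induction n with
    | zero =>
      have h0 : PowerSeries.coeff 0 (∏ j ∈ s, posGeom (μ j)) = 0 := by
        obtain ⟨b, hb⟩ := hs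
        rw [← Finset.mul_prod_erase s _ hb, PowerSeries.coeff_mul, Finset.Nat.antidiagonal_zero, Finset.sum_singleton,
          constantCoeff_posGeom, zero_mul]
      rw [coeff_succ_posGeom_mul, PowerSeries.coeff_mul, Finset.Nat.antidiagonal_zero, Finset.sum_singleton, h0, mul_zero, add_zero, mul_zero]
      have := sum_mul_prod_div_sub_eq_zero μ (insert a s)
        (by rw [Finset.card_insert_of_notMem ha]; have := hs.card_pos; omega) hμ
      simpa using this.symm
    | succ n ihn =>
      rw [coeff_succ_posGeom_mul, ihn, ih', Finset.sum_insert ha, Finset.sum_insert ha]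
      have h : ∀ j ∈ s, μ j ^ (n + 1 + 1) * ∏ i ∈ (insert a s).erase j, μ i / (μ j - μ i) =
          μ a * (μ j ^ (n + 1) * ∏ i ∈ s.erase j, μ i / (μ j - μ i)) +
          μ a * (μ j ^ (n + 1) * ∏ i ∈ (insert a s).erase j, μ i / (μ j - μ i)) := by
        intro j hj
        have hja : j ≠ a := fun h => ha (h ▸ hj)
        have hsub : μ j - μ a ≠ 0 := sub_ne_zero.2 fun h =>
          hja (hμ (by simp [hj]) (by simp) h)
        rw [Finset.erase_insert_of_ne hja.symm, Finset.prod_insert (by simp [ha])]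
        field_simp
        ring
      rw [Finset.sum_congr rfl h, Finset.sum_add_distrib, ← Finset.mul_sum, ← Finset.mul_sum]
      ring

lemma sum_powersetCard_succ_sum_erase {ι M : Type*} [DecidableEq ι] [AddCommMonoid M]
    (s : Finset ι) (p : ℕ) (g : ι → Finset ι → M) :
    ∑ J ∈ s.powersetCard (p + 1), ∑ j ∈ J, g j (J.erase j) =
      ∑ j ∈ s, ∑ I ∈ (s.erase j).powersetCard p, g j I := by
  rw [Finset.sum_sigma', Finset.sum_sigma']
  refine Finset.sum_bij' (fun x _ => ⟨x.2, x.1.erase x.2⟩) (fun x _ => ⟨insert x.1 x.2, x.1⟩)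
    ?_ ?_ ?_ ?_ ?_
  · rintro ⟨J, j⟩ h
    simp only [Finset.mem_sigma, Finset.mem_powersetCard] at h ⊢
    exact ⟨h.1.1 h.2, Finset.erase_subset_erase _ h.1.1, by
      rw [Finset.card_erase_of_mem h.2]; omega⟩
  · rintro ⟨j, I⟩ h
    simp only [Finset.mem_sigma, Finset.mem_powersetCard, Finset.subset_erase] at h ⊢
    exact ⟨⟨Finset.insert_subset h.1 h.2.1.1, by
      rw [Finset.card_insert_of_notMem h.2.1.2, h.2.2]⟩, Finset.mem_insert_self _ _⟩
  · rintro ⟨J, j⟩ h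
    simp only [Finset.mem_sigma] at h
    simp [Finset.insert_erase h.2]
  · rintro ⟨j, I⟩ h
    simp only [Finset.mem_sigma, Finset.mem_powersetCard, Finset.subset_erase] at h
    simp [Finset.erase_insert h.2.1.2]
  · rintro ⟨J, j⟩ _
    rfl

lemma Ctil_eq_sum_range {k : ℕ} (hk : 1 ≤ k) (ν μ : Fin k → ℂ) (ω : ℂ) (j : Fin k) :
    Ctil ν μ ω j = ∑ p ∈ Finset.range k, ω ^ p *
      ∑ I ∈ Finset.powersetCard p (Finset.univ.erase j),
        ν j * ∏ i ∈ I, (ν i * μ i / (μ j - μ i)) := by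
  obtain ⟨k, rfl⟩ := Nat.exists_eq_add_of_le' hk
  rw [Finset.sum_range_succ', Ctil, Nat.add_sub_cancel, Finset.range_eq_Ico,
    Finset.sum_Ico_add' (fun p => ω ^ p *
      ∑ I ∈ Finset.powersetCard p (Finset.univ.erase j),
        ν j * ∏ i ∈ I, (ν i * μ i / (μ j - μ i))) 0 k 1, add_comm (ν j), Finset.mul_sum]
  congr 1
  · refine Finset.sum_congr (by ext; simp) fun p _ => ?_
    rw [← Finset.mul_sum]
    ring
  · simp

/-- `θ̃_ℓ(ν,μ,ω) = Σ_j μ_j^ℓ C̃_j(ν,μ,ω)` for `μ` with pairwise distinct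
coordinates. -/
theorem statement16 (k : ℕ) (hk : 1 ≤ k) (ν μ : Fin k → ℂ)
    (hμ : Function.Injective μ) (ω : ℂ) (ℓ : ℕ) (hℓ : 1 ≤ ℓ) :
    thetaT ν μ ω ℓ = ∑ j : Fin k, μ j ^ ℓ * Ctil ν μ ω j := by
  obtain ⟨n, rfl⟩ := Nat.exists_eq_add_of_le' hℓ
  have hIcc : Finset.Icc 1 k = Finset.Ico (0 + 1) (k + 1) := by ext; simp
  rw [thetaT, hIcc, ← Finset.sum_Ico_add', ← Finset.range_eq_Ico]
  simp_rw [Ctil_eq_sum_range hk, Finset.mul_sum (Finset.range k)]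
  rw [Finset.sum_comm]
  refine Finset.sum_congr rfl fun p _ => ?_
  rw [Nat.add_sub_cancel]
  simp_rw [mul_left_comm _ (ω ^ p)]
  rw [← Finset.mul_sum]
  congr 1
  simp_rw [Finset.mul_sum]
  rw [← sum_powersetCard_succ_sum_erase Finset.univ p
    fun j I => μ j ^ (n + 1) * (ν j * ∏ i ∈ I, (ν i * μ i / (μ j - μ i)))]
  refine Finset.sum_congr rfl fun J hJ => ?_
  have hcard := (Finset.mem_powersetCard.1 hJ).2
  rw [← Finset.mul_sum, ← coeff_prod_posGeom,
    coeff_succ_prod_posGeom μ J (Finset.card_pos.1 (by omega)) hμ.injOn, Finset.mul_sum]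
  refine Finset.sum_congr rfl fun j hj => ?_
  rw [← Finset.mul_prod_erase J ν hj]
  simp_rw [mul_div_assoc, Finset.prod_mul_distrib]
  ring

end
end
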